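/- (Optimality of the ILQR correction sequence for the linearized attack problem.) Under the setup of the paper's Theorem 2 — λ > 0, integers τ ≤ L, measurement matrix C (n×n), matrices D_{x,s} (n×n) and vectors D_{u,s} ∈ ℝⁿ and scalars ũ_s ∈ ℝ for s = τ, …, L, symmetric positive semidefinite matrices Q_s, nominal states x̃_s ∈ ℝⁿ and targets y†_s ∈ ℝⁿ for s = τ, …, L+1, with P_s and q_s defined by the backward recursion of Theorem 2 — consider, for any correction sequence δu = (δu_τ, …, δu_L) ∈ ℝ^{L−τ+1}, the trajectory δx_τ(δu) = 0, δx_{s+1}(δu) = D_{x,s} δx_s(δu) + δu_s · D_{u,s}, and the cost J(δu) = Σ_{s=τ+1}^{L+1} (C(δx_s(δu) + x̃_s) − y†_s)ᵀ Q_s (C(δx_s(δu) + x̃_s) − y†_s) + λ·Σ_{s=τ}^{L} (δu_s + ũ_s)². Let δu* be the sequence defined along its own trajectory by δu*_s = −(2·D_{u,s}ᵀ P_{s+1} D_{x,s} δx_s(δu*) + D_{u,s}ᵀ q_{s+1} + 2 λ ũ_s)/(2·(λ + D_{u,s}ᵀ P_{s+1} D_{u,s})). Then J(δu*) ≤ J(δu)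 for every sequence δu ∈ ℝ^{L−τ+1}. -/

import Mathlib

open Matrix

/-- The linearized deviation trajectory of the ILQR subproblem:
`ilqrTraj Dx Du τ du k` is the deviation `δx_{τ+k}` with `δx_τ = 0` and
`δx_{s+1} = D_{x,s} δx_s + δu_s • D_{u,s}`. -/
def ilqrTraj {n : ℕ} (Dx : ℕ → Matrix (Fin n) (Fin n) ℝ) (Du : ℕ → Fin n → ℝ)
    (τ : ℕ) (du : ℕ → ℝ) : ℕ → Fin n → ℝ
  | 0 => 0
  | k + 1 => (Dx (τ + k)).mulVec (ilqrTraj Dx Du τ du k) + du (τ + k) • Du (τ + k)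

namespace Matrix

variable {n : Type*} [Fintype n]

theorem IsSymm.dotProduct_mulVec_comm {A : Matrix n n ℝ} (hA : A.IsSymm) (x y : n → ℝ) :
    x ⬝ᵥ A *ᵥ y = y ⬝ᵥ A *ᵥ x := by
  rw [dotProduct_mulVec, ← mulVec_transpose, hA.eq, dotProduct_comm]

theorem IsSymm.add_dotProduct_mulVec_add {A : Matrix n n ℝ} (hA : A.IsSymm) (x y : n → ℝ) :
    (x + y) ⬝ᵥ A *ᵥ (x + y) = x ⬝ᵥ A *ᵥ x + 2 * (x ⬝ᵥ A *ᵥ y) + y ⬝ᵥ A *ᵥ y := by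
  rw [mulVec_add, dotProduct_add, add_dotProduct, add_dotProduct,
    hA.dotProduct_mulVec_comm y x]
  ring

theorem IsSymm.dotProduct_mulVec_add_smul {A : Matrix n n ℝ} (hA : A.IsSymm)
    (x d : n → ℝ) (u : ℝ) :
    (x + u • d) ⬝ᵥ A *ᵥ (x + u • d) =
      x ⬝ᵥ A *ᵥ x + 2 * u * (d ⬝ᵥ A *ᵥ x) + u ^ 2 * (d ⬝ᵥ A *ᵥ d) := by
  rw [hA.add_dotProduct_mulVec_add]
  simp only [mulVec_smul, dotProduct_smul, smul_dotProduct, smul_eq_mul,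
    hA.dotProduct_mulVec_comm x d]
  ring

theorem dotProduct_transpose_mul_mul_mulVec (A B : Matrix n n ℝ) (x y : n → ℝ) :
    x ⬝ᵥ (Bᵀ * A * B) *ᵥ y = (B *ᵥ x) ⬝ᵥ A *ᵥ (B *ᵥ y) := by
  rw [← mulVec_mulVec, ← mulVec_mulVec, dotProduct_mulVec, vecMul_transpose]

theorem IsSymm.transpose_mul_mul {A : Matrix n n ℝ} (hA : A.IsSymm) (B : Matrix n n ℝ) :
    (Bᵀ * A * B).IsSymm := by
  simp [IsSymm, transpose_mul, hA.eq, Matrix.mul_assoc]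

theorem IsSymm.dotProduct_rankOne_mulVec {A : Matrix n n ℝ} (hA : A.IsSymm)
    (B : Matrix n n ℝ) (d x : n → ℝ) :
    x ⬝ᵥ (Bᵀ * A * vecMulVec d d * A * B) *ᵥ x = (d ⬝ᵥ A *ᵥ (B *ᵥ x)) ^ 2 := by
  have h : Bᵀ * A * vecMulVec d d * A * B = Bᵀ * (A * vecMulVec d d * A) * B := by
    simp only [Matrix.mul_assoc]
  rw [h, dotProduct_transpose_mul_mul_mulVec, ← mulVec_mulVec, ← mulVec_mulVec,
    vecMulVec_mulVec]
  simp only [op_smul_eq_smul, mulVec_smul, dotProduct_smul, smul_eq_mul,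
    hA.dotProduct_mulVec_comm (B *ᵥ x) d]
  ring

end Matrix

section Riccati

variable {n : ℕ} {lam : ℝ} {C D Q P P' : Matrix (Fin n) (Fin n) ℝ} {d : Fin n → ℝ}

/-- One step of the Riccati recursion, evaluated as a quadratic form. -/
theorem riccati_quadForm (hP' : P'.IsSymm)
    (hP : P = Cᵀ * Q * C + Dᵀ * P' * D
      - (1 / (lam + d ⬝ᵥ P' *ᵥ d)) • (Dᵀ * P' * vecMulVec d d * P' * D)) (x : Fin n → ℝ) :
    x ⬝ᵥ P *ᵥ x = (C *ᵥ x) ⬝ᵥ Q *ᵥ (C *ᵥ x) + (D *ᵥ x) ⬝ᵥ P' *ᵥ (D *ᵥ x)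
      - (d ⬝ᵥ P' *ᵥ (D *ᵥ x)) ^ 2 / (lam + d ⬝ᵥ P' *ᵥ d) := by
  rw [hP, sub_mulVec, add_mulVec, smul_mulVec, dotProduct_sub, dotProduct_add, dotProduct_smul,
    hP'.dotProduct_rankOne_mulVec, dotProduct_transpose_mul_mul_mulVec,
    dotProduct_transpose_mul_mul_mulVec, smul_eq_mul]
  ring

/-- The Riccati recursion preserves symmetry and nonnegativity. -/
theorem riccati_posSemidef (hlam : 0 < lam)
    (hQ : Q.IsSymm ∧ ∀ x, 0 ≤ x ⬝ᵥ Q *ᵥ x) (hP' : P'.IsSymm ∧ ∀ x, 0 ≤ x ⬝ᵥ P' *ᵥ x)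
    (hP : P = Cᵀ * Q * C + Dᵀ * P' * D
      - (1 / (lam + d ⬝ᵥ P' *ᵥ d)) • (Dᵀ * P' * vecMulVec d d * P' * D)) :
    P.IsSymm ∧ ∀ x, 0 ≤ x ⬝ᵥ P *ᵥ x := by
  constructor
  · have h : Dᵀ * P' * vecMulVec d d * P' * D = Dᵀ * (P'ᵀ * vecMulVec d d * P') * D := by
      simp only [Matrix.mul_assoc, hP'.1.eq]
    have hd : (vecMulVec d d).IsSymm := transpose_vecMulVec d d
    rw [hP, h]
    exact ((hQ.1.transpose_mul_mul C).add (hP'.1.transpose_mul_mul D)).sub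
      (((hd.transpose_mul_mul P').transpose_mul_mul D).smul _)
  · intro x
    rw [riccati_quadForm hP'.1 hP]
    have ha : 0 < lam + d ⬝ᵥ P' *ᵥ d := by linarith [hP'.2 d]
    have h := hP'.2 (D *ᵥ x + (-(d ⬝ᵥ P' *ᵥ (D *ᵥ x)) / (lam + d ⬝ᵥ P' *ᵥ d)) • d)
    rw [hP'.1.dotProduct_mulVec_add_smul] at h
    have hC := hQ.2 (C *ᵥ x)
    generalize d ⬝ᵥ P' *ᵥ (D *ᵥ x) = g at *
    have hsq : 0 ≤ lam * (-g / (lam + d ⬝ᵥ P' *ᵥ d)) ^ 2 := by positivity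
    have key : 2 * (-g / (lam + d ⬝ᵥ P' *ᵥ d)) * g
        + (-g / (lam + d ⬝ᵥ P' *ᵥ d)) ^ 2 * (d ⬝ᵥ P' *ᵥ d)
        + lam * (-g / (lam + d ⬝ᵥ P' *ᵥ d)) ^ 2 = -(g ^ 2 / (lam + d ⬝ᵥ P' *ᵥ d)) := by
      field_simp
      ring
    linarith

theorem measurementCost_expand (hQ : Q.IsSymm) (x t y : Fin n → ℝ) :
    (C *ᵥ (x + t) - y) ⬝ᵥ Q *ᵥ (C *ᵥ (x + t) - y) =
      (C *ᵥ x) ⬝ᵥ Q *ᵥ (C *ᵥ x) + 2 * ((C *ᵥ x) ⬝ᵥ Q *ᵥ (C *ᵥ t - y))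
        + (C *ᵥ t - y) ⬝ᵥ Q *ᵥ (C *ᵥ t - y) := by
  rw [mulVec_add, add_sub_assoc, hQ.add_dotProduct_mulVec_add]

theorem dotProduct_transpose_mul_mulVec (x w : Fin n → ℝ) :
    ((Cᵀ * Q) *ᵥ w) ⬝ᵥ x = (C *ᵥ x) ⬝ᵥ Q *ᵥ w := by
  rw [dotProduct_comm, ← mulVec_mulVec, dotProduct_mulVec, vecMul_transpose]

/-- Completing the square in one step of the backward recursion. -/
theorem bellman_step {q q' t y : Fin n → ℝ} {v : ℝ} (hQ : Q.IsSymm) (hP' : P'.IsSymm)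
    (ha : lam + d ⬝ᵥ P' *ᵥ d ≠ 0)
    (hP : P = Cᵀ * Q * C + Dᵀ * P' * D
      - (1 / (lam + d ⬝ᵥ P' *ᵥ d)) • (Dᵀ * P' * vecMulVec d d * P' * D))
    (hq : q = (2 : ℝ) • (Cᵀ * Q) *ᵥ (C *ᵥ t - y) + Dᵀ *ᵥ q'
      - ((d ⬝ᵥ q' + 2 * lam * v) / (lam + d ⬝ᵥ P' *ᵥ d)) • (Dᵀ * P') *ᵥ d) :
    ∃ c : ℝ, ∀ (x : Fin n → ℝ) (u : ℝ),
    (C *ᵥ (x + t) - y) ⬝ᵥ Q *ᵥ (C *ᵥ (x + t) - y) + lam * (u + v) ^ 2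
        + ((D *ᵥ x + u • d) ⬝ᵥ P' *ᵥ (D *ᵥ x + u • d) + q' ⬝ᵥ (D *ᵥ x + u • d)) =
      x ⬝ᵥ P *ᵥ x + q ⬝ᵥ x + c
        + (lam + d ⬝ᵥ P' *ᵥ d) * (u - -(2 * (d ⬝ᵥ P' *ᵥ (D *ᵥ x)) + d ⬝ᵥ q' + 2 * lam * v)
            / (2 * (lam + d ⬝ᵥ P' *ᵥ d))) ^ 2 := by
  refine ⟨(C *ᵥ t - y) ⬝ᵥ Q *ᵥ (C *ᵥ t - y) + lam * v ^ 2
    - (d ⬝ᵥ q' + 2 * lam * v) ^ 2 / (4 * (lam + d ⬝ᵥ P' *ᵥ d)), fun x u => ?_⟩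
  have hqx : q ⬝ᵥ x = 2 * ((C *ᵥ x) ⬝ᵥ Q *ᵥ (C *ᵥ t - y)) + q' ⬝ᵥ (D *ᵥ x)
      - (d ⬝ᵥ q' + 2 * lam * v) / (lam + d ⬝ᵥ P' *ᵥ d) * (d ⬝ᵥ P' *ᵥ (D *ᵥ x)) := by
    rw [hq, sub_dotProduct, add_dotProduct, smul_dotProduct, smul_dotProduct,
      dotProduct_transpose_mul_mulVec, dotProduct_transpose_mul_mulVec,
      mulVec_transpose, ← dotProduct_mulVec, hP'.dotProduct_mulVec_comm (D *ᵥ x) d,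
      smul_eq_mul, smul_eq_mul]
  rw [measurementCost_expand hQ, hP'.dotProduct_mulVec_add_smul, riccati_quadForm hP' hP, hqx,
    dotProduct_add, dotProduct_smul, dotProduct_comm q' d, smul_eq_mul]
  generalize d ⬝ᵥ P' *ᵥ (D *ᵥ x) = g
  generalize hA : lam + d ⬝ᵥ P' *ᵥ d = A at *
  obtain rfl : lam = A - d ⬝ᵥ P' *ᵥ d := by linarith
  field_simp
  ring

end Riccati

/-- Optimality of the ILQR correction sequence for the linearized
attack problem: the correction sequence `δu*` defined along its own trajectory by
the closed-form ILQR policy minimizes the linearized attack cost `J`. -/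
theorem stmt10 {n : ℕ} (hn : 0 < n)
    (lam : ℝ) (hlam : 0 < lam) (τ L : ℕ) (hτL : τ ≤ L)
    (C : Matrix (Fin n) (Fin n) ℝ)
    (Dx : ℕ → Matrix (Fin n) (Fin n) ℝ) (Du : ℕ → Fin n → ℝ) (ut : ℕ → ℝ)
    (xt : ℕ → Fin n → ℝ) (Q : ℕ → Matrix (Fin n) (Fin n) ℝ)
    (ytgt : ℕ → Fin n → ℝ)
    (hQ : ∀ s, τ ≤ s → s ≤ L + 1 →
      (Q s).IsSymm ∧ ∀ x : Fin n → ℝ, 0 ≤ x ⬝ᵥ (Q s).mulVec x)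
    (P : ℕ → Matrix (Fin n) (Fin n) ℝ) (q : ℕ → Fin n → ℝ)
    (hPL : P (L + 1) = Cᵀ * Q (L + 1) * C)
    (hqL : q (L + 1) = (2 : ℝ) •
      (Cᵀ * Q (L + 1)).mulVec (C.mulVec (xt (L + 1)) - ytgt (L + 1)))
    (hPrec : ∀ s, τ ≤ s → s ≤ L →
      P s = Cᵀ * Q s * C + (Dx s)ᵀ * P (s + 1) * Dx s
        - (1 / (lam + Du s ⬝ᵥ (P (s + 1)).mulVec (Du s))) •
            ((Dx s)ᵀ * P (s + 1) * vecMulVec (Du s) (Du s) * P (s + 1) * Dx s))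
    (hqrec : ∀ s, τ ≤ s → s ≤ L →
      q s = (2 : ℝ) • (Cᵀ * Q s).mulVec (C.mulVec (xt s) - ytgt s)
        + (Dx s)ᵀ.mulVec (q (s + 1))
        - ((Du s ⬝ᵥ q (s + 1) + 2 * lam * ut s)
            / (lam + Du s ⬝ᵥ (P (s + 1)).mulVec (Du s))) •
              ((Dx s)ᵀ * P (s + 1)).mulVec (Du s))
    (J : (ℕ → ℝ) → ℝ)
    (hJ : ∀ du : ℕ → ℝ, J du =
      (∑ s ∈ Finset.Icc (τ + 1) (L + 1),
        (C.mulVec (ilqrTraj Dx Du τ du (s - τ) + xt s) - ytgt s) ⬝ᵥ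
          (Q s).mulVec (C.mulVec (ilqrTraj Dx Du τ du (s - τ) + xt s) - ytgt s))
      + lam * ∑ s ∈ Finset.Icc τ L, (du s + ut s) ^ 2)
    (dustar : ℕ → ℝ)
    (hdustar : ∀ s, τ ≤ s → s ≤ L →
      dustar s = -(2 * (Du s ⬝ᵥ (P (s + 1)).mulVec
            ((Dx s).mulVec (ilqrTraj Dx Du τ dustar (s - τ))))
          + Du s ⬝ᵥ q (s + 1) + 2 * lam * ut s)
        / (2 * (lam + Du s ⬝ᵥ (P (s + 1)).mulVec (Du s)))) :
    ∀ du : ℕ → ℝ, J dustar ≤ J du := by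
  have hpsd : ∀ s, τ ≤ s → s ≤ L + 1 →
      (P s).IsSymm ∧ ∀ x : Fin n → ℝ, 0 ≤ x ⬝ᵥ (P s).mulVec x := by
    intro s hs hsL
    induction hsL using Nat.decreasingInduction with
    | self =>
      obtain ⟨hsymm, hnonneg⟩ := hQ (L + 1) hs le_rfl
      rw [hPL]
      refine ⟨hsymm.transpose_mul_mul C, fun x => ?_⟩
      rw [dotProduct_transpose_mul_mul_mulVec]
      exact hnonneg _
    | of_succ s hsL' ih =>
      exact riccati_posSemidef hlam (hQ s hs hsL'.le) (ih (by omega))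
        (hPrec s hs (by omega))
  have hapos : ∀ s, τ ≤ s → s ≤ L → 0 < lam + Du s ⬝ᵥ (P (s + 1)).mulVec (Du s) :=
    fun s hs hsL => by linarith [(hpsd (s + 1) (by omega) (by omega)).2 (Du s)]
  let ℓ : ℕ → (Fin n → ℝ) → ℝ := fun s x =>
    (C.mulVec (x + xt s) - ytgt s) ⬝ᵥ (Q s).mulVec (C.mulVec (x + xt s) - ytgt s)
  let W : ℕ → (Fin n → ℝ) → ℝ := fun s x => x ⬝ᵥ (P s).mulVec x + q s ⬝ᵥ x
  let a : ℕ → ℝ := fun s => lam + Du s ⬝ᵥ (P (s + 1)).mulVec (Du s)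
  let policy : ℕ → (Fin n → ℝ) → ℝ := fun s x =>
    -(2 * (Du s ⬝ᵥ (P (s + 1)).mulVec ((Dx s).mulVec x)) + Du s ⬝ᵥ q (s + 1)
      + 2 * lam * ut s) / (2 * a s)
  have hsum : ∀ k, τ + k ≤ L + 1 → ∃ K : ℝ, ∀ du : ℕ → ℝ,
      ∑ i ∈ Finset.range k, ℓ (τ + i) (ilqrTraj Dx Du τ du i)
        + lam * ∑ i ∈ Finset.range k, (du (τ + i) + ut (τ + i)) ^ 2
        + W (τ + k) (ilqrTraj Dx Du τ du k) =
      K + ∑ i ∈ Finset.range k,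
        a (τ + i) * (du (τ + i) - policy (τ + i) (ilqrTraj Dx Du τ du i)) ^ 2 := by
    intro k
    induction k with
    | zero => exact fun _ => ⟨0, fun du => by simp [W, ilqrTraj]⟩
    | succ k ih =>
      intro hk
      obtain ⟨K, hK⟩ := ih (by omega)
      obtain ⟨c, hstep⟩ := bellman_step (hQ (τ + k) (by omega) (by omega)).1
        (hpsd (τ + k + 1) (by omega) (by omega)).1
        (hapos (τ + k) (by omega) (by omega)).ne'
        (hPrec (τ + k) (by omega) (by omega)) (hqrec (τ + k) (by omega) (by omega))
      refine ⟨K + c, fun du => ?_⟩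
      have h := hstep (ilqrTraj Dx Du τ du k) (du (τ + k))
      have h' := hK du
      rw [Finset.sum_range_succ, Finset.sum_range_succ, Finset.sum_range_succ]
      simp only [ℓ, W, a, policy, ← add_assoc, ilqrTraj] at h h' ⊢
      linear_combination h + h'
  have hJ' : ∃ K : ℝ, ∀ du : ℕ → ℝ, J du = K + ∑ i ∈ Finset.range (L - τ + 1),
      a (τ + i) * (du (τ + i) - policy (τ + i) (ilqrTraj Dx Du τ du i)) ^ 2 := by
    obtain ⟨K, hK⟩ := hsum (L - τ + 1) (by omega)
    refine ⟨K - ℓ τ 0 + (C.mulVec (xt (L + 1)) - ytgt (L + 1)) ⬝ᵥ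
      (Q (L + 1)).mulVec (C.mulVec (xt (L + 1)) - ytgt (L + 1)), fun du => ?_⟩
    have hW : ∀ x, W (L + 1) x = ℓ (L + 1) x - (C.mulVec (xt (L + 1)) - ytgt (L + 1)) ⬝ᵥ
        (Q (L + 1)).mulVec (C.mulVec (xt (L + 1)) - ytgt (L + 1)) := by
      intro x
      simp only [W, ℓ]
      rw [measurementCost_expand (hQ (L + 1) (by omega) le_rfl).1, hPL, hqL,
        dotProduct_transpose_mul_mul_mulVec, smul_dotProduct, dotProduct_transpose_mul_mulVec,
        smul_eq_mul]
      ring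
    have hstate : ∑ s ∈ Finset.Icc (τ + 1) (L + 1), ℓ s (ilqrTraj Dx Du τ du (s - τ)) =
        ∑ i ∈ Finset.range (L - τ + 1), ℓ (τ + i) (ilqrTraj Dx Du τ du i)
          + ℓ (L + 1) (ilqrTraj Dx Du τ du (L - τ + 1)) - ℓ τ 0 := by
      have hlast : L + 1 = τ + (L - τ + 1) := by omega
      have h := Finset.sum_range_succ (fun i => ℓ (τ + i) (ilqrTraj Dx Du τ du i)) (L - τ + 1)
      rw [Finset.sum_range_succ', ← hlast] at h
      rw [← h, ← Finset.Ico_add_one_right_eq_Icc, Finset.sum_Ico_eq_sum_range]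
      have hcard : L + 1 + 1 - (τ + 1) = L - τ + 1 := by omega
      simp only [hcard, add_zero, ilqrTraj.eq_1, add_sub_cancel_right]
      refine Finset.sum_congr rfl fun i _ => ?_
      rw [show τ + 1 + i = τ + (i + 1) by omega, Nat.add_sub_cancel_left]
    have hcontrol : ∑ s ∈ Finset.Icc τ L, (du s + ut s) ^ 2 =
        ∑ i ∈ Finset.range (L - τ + 1), (du (τ + i) + ut (τ + i)) ^ 2 := by
      rw [← Finset.Ico_add_one_right_eq_Icc, Finset.sum_Ico_eq_sum_range,
        Nat.sub_add_comm hτL]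
    have h := hK du
    rw [show τ + (L - τ + 1) = L + 1 by omega, hW] at h
    rw [hJ, hcontrol]
    linear_combination h + hstate
  obtain ⟨K, hK⟩ := hJ'
  intro du
  have hzero : ∑ i ∈ Finset.range (L - τ + 1), a (τ + i) *
      (dustar (τ + i) - policy (τ + i) (ilqrTraj Dx Du τ dustar i)) ^ 2 = 0 := by
    refine Finset.sum_eq_zero fun i hi => ?_
    have hi' := Finset.mem_range.mp hi
    have h := hdustar (τ + i) (by omega) (by omega)
    rw [Nat.add_sub_cancel_left] at h
    rw [h, sub_self]
    ring
  have hnonneg : 0 ≤ ∑ i ∈ Finset.range (L - τ + 1), a (τ + i) *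
      (du (τ + i) - policy (τ + i) (ilqrTraj Dx Du τ du i)) ^ 2 := by
    refine Finset.sum_nonneg fun i hi => ?_
    have hi' := Finset.mem_range.mp hi
    exact mul_nonneg (hapos (τ + i) (by omega) (by omega)).le (sq_nonneg _)
  rw [hK, hK, hzero]
  linarith
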